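/- GL₃(ℤ) does not contain an infinite subgroup admitting a sharply 3-transitive action on some set. -/

import Mathlib

open Matrix

namespace Sharp3

/-- The companion-type normal form of an order three matrix. -/
def C : Matrix (Fin 3) (Fin 3) ℚ := !![1, 0, 0; 0, 0, -1; 0, 1, -1]

/-- The general element of the commutant of `C`. -/
def D (α β γ : ℚ) : Matrix (Fin 3) (Fin 3) ℚ := !![α, 0, 0; 0, β, -γ; 0, γ, β - γ]

lemma commutant (E : Matrix (Fin 3) (Fin 3) ℚ) (h : E * C = C * E) :
    E = D (E 0 0) (E 1 1) (E 2 1) := by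
  have key : ∀ i j, (E * C) i j = (C * E) i j := fun i j => by rw [h]
  have h01 := key 0 1
  have h02 := key 0 2
  have h10 := key 1 0
  have h20 := key 2 0
  have h11 := key 1 1
  have h12 := key 1 2
  have h21 := key 2 1
  have h22 := key 2 2
  simp [C, Matrix.mul_apply, Fin.sum_univ_three] at h01 h02 h10 h20 h11 h12 h21 h22
  ext i j
  fin_cases i <;> fin_cases j <;> simp [D] <;> linarith

/-- Normal form of an order three rational matrix. -/
lemma normal_form (R : Matrix (Fin 3) (Fin 3) ℚ) (h3 : R * R * R = 1) (h1 : R ≠ 1) :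
    ∃ P : Matrix (Fin 3) (Fin 3) ℚ, P.det ≠ 0 ∧ R * P = P * C := by
  have hS : R * R + R + 1 ≠ 0 := by
    intro h
    have h2 : (R + R + 1) * (R + R + 1) = (-3 : ℚ) • (1 : Matrix (Fin 3) (Fin 3) ℚ) := by
      have e : (R + R + 1) * (R + R + 1) = 4 • (R * R + R + 1) - 3 • 1 := by noncomm_ring
      rw [e, h, smul_zero, zero_sub]; module
    have := congrArg Matrix.det h2
    rw [Matrix.det_mul, Matrix.det_smul] at this
    simp at this
    nlinarith [mul_self_nonneg (R + R + 1).det]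
  have hv : ∃ u, (R * R + R + 1) *ᵥ u ≠ 0 := by
    by_contra! hc
    exact hS (Matrix.ext_of_mulVec_single fun i => by rw [hc, Matrix.zero_mulVec])
  have hw : ∃ u, (R - 1) *ᵥ u ≠ 0 := by
    by_contra! hc
    exact (sub_ne_zero.2 h1) (Matrix.ext_of_mulVec_single fun i => by rw [hc, Matrix.zero_mulVec])
  obtain ⟨u, hu⟩ := hv
  obtain ⟨u', hu'⟩ := hw
  obtain ⟨v, hv⟩ : ∃ v, v = (R * R + R + 1) *ᵥ u := ⟨_, rfl⟩
  obtain ⟨w, hw⟩ : ∃ w, w = (R - 1) *ᵥ u' := ⟨_, rfl⟩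
  rw [← hv] at hu
  rw [← hw] at hu'
  have Rv : R *ᵥ v = v := by
    rw [hv, Matrix.mulVec_mulVec]
    congr 1
    rw [mul_add, mul_add, ← mul_assoc, h3]; noncomm_ring
  have Rw : R *ᵥ (R *ᵥ w) = - w - R *ᵥ w := by
    have : (R * R + R + 1) *ᵥ w = 0 := by
      rw [hw, Matrix.mulVec_mulVec]
      have : (R * R + R + 1) * (R - 1) = 0 := by
        have : (R * R + R + 1) * (R - 1) = R * R * R - 1 := by noncomm_ring
        rw [this, h3, sub_self]
      rw [this, Matrix.zero_mulVec]
    rw [Matrix.add_mulVec, Matrix.add_mulVec, Matrix.one_mulVec, ← Matrix.mulVec_mulVec] at this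
    linear_combination this
  obtain ⟨z, hz⟩ : ∃ z, z = R *ᵥ w := ⟨_, rfl⟩
  rw [← hz] at Rw
  refine ⟨(Matrix.of ![v, w, z])ᵀ, ?_, ?_⟩
  · intro hdet
    obtain ⟨x, hx0, hx⟩ := Matrix.exists_mulVec_eq_zero_iff.2 hdet
    have e : x 0 • v + x 1 • w + x 2 • z = 0 := by
      rw [← hx]
      ext i
      simp [Matrix.mulVec, dotProduct, Fin.sum_univ_three]; ring
    have e1 : x 0 • v + x 1 • z + x 2 • (-w - z) = 0 := by
      have := congrArg (R *ᵥ ·) e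
      simpa [Matrix.mulVec_add, Matrix.mulVec_smul, Rv, ← hz, Rw] using this
    have e2 : x 0 • v + x 1 • (-w - z) + x 2 • w = 0 := by
      have := congrArg (R *ᵥ ·) e1
      simp [Matrix.mulVec_add, Matrix.mulVec_sub, Matrix.mulVec_neg, Matrix.mulVec_smul,
        Rv, ← hz, Rw] at this
      rw [← this]; congr 2; abel
    have a0 : x 0 = 0 := by
      have : (3 * x 0) • v = 0 := by
        
        calc (3 * x 0) • v = (x 0 • v + x 1 • w + x 2 • z) + (x 0 • v + x 1 • z + x 2 • (-w - z))
              + (x 0 • v + x 1 • (-w - z) + x 2 • w) := by module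
          _ = 0 := by rw [e, e1, e2]; simp
      rcases smul_eq_zero.1 this with h | h
      · linarith
      · exact absurd h hu
    have q0 : x 1 ^ 2 - x 1 * x 2 + x 2 ^ 2 = 0 := by
      rw [a0] at e e1
      have : (x 1 ^ 2 - x 1 * x 2 + x 2 ^ 2) • w = 0 := by
        
        calc (x 1 ^ 2 - x 1 * x 2 + x 2 ^ 2) • w
            = (x 1 - x 2) • ((0 : ℚ) • v + x 1 • w + x 2 • z)
              - x 2 • ((0 : ℚ) • v + x 1 • z + x 2 • (-w - z)) := by module
          _ = 0 := by rw [e, e1]; simp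
      rcases smul_eq_zero.1 this with h | h
      · exact h
      · exact absurd h hu'
    have b0 : x 1 = 0 := by nlinarith [sq_nonneg (x 1), sq_nonneg (x 1 - 2 * x 2)]
    have c0 : x 2 = 0 := by nlinarith [sq_nonneg (x 2), sq_nonneg (x 2 - 2 * x 1)]
    apply hx0
    ext i
    fin_cases i <;> simp [a0, b0, c0]
  · have key : ∀ i, (R *ᵥ v) i = v i ∧ (R *ᵥ w) i = z i ∧ (R *ᵥ z) i = - w i - z i := by
      intro i
      refine ⟨by rw [Rv], by rw [hz], by rw [Rw]; simp⟩
    ext i j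
    obtain ⟨k1, k2, k3⟩ := key i
    simp only [Matrix.mulVec, dotProduct, Fin.sum_univ_three] at k1 k2 k3
    fin_cases j <;> simp [Matrix.mul_apply, Fin.sum_univ_three, C] <;> linarith

lemma bounds (a b c : ℤ) (h : a * (b ^ 2 - b * c + c ^ 2) = 27 ∨
    a * (b ^ 2 - b * c + c ^ 2) = -27) :
    a ∈ Set.Icc (-27) 27 ∧ b ∈ Set.Icc (-6) 6 ∧ c ∈ Set.Icc (-6 : ℤ) 6 := by
  have ha : a ∣ 27 := by
    rcases h with h | h
    · exact ⟨_, h.symm⟩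
    · exact (Int.dvd_neg).1 ⟨_, h.symm⟩
  have hq : (b ^ 2 - b * c + c ^ 2) ∣ 27 := by
    rcases h with h | h
    · exact Dvd.intro_left _ h
    · exact (Int.dvd_neg).1 (Dvd.intro_left _ h)
  have hq' := Int.le_of_dvd (by norm_num) hq
  have h1 := Int.le_of_dvd (by norm_num) ha
  have h2 := Int.le_of_dvd (by norm_num) ((neg_dvd).2 ha)
  refine ⟨⟨by linarith, h1⟩, ⟨?_, ?_⟩, ?_, ?_⟩
  · nlinarith [sq_nonneg (b - 2 * c)]
  · nlinarith [sq_nonneg (b - 2 * c)]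
  · nlinarith [sq_nonneg (c - 2 * b)]
  · nlinarith [sq_nonneg (c - 2 * b)]

lemma finite_centralizer (r : GL (Fin 3) ℤ) (h3 : r * r * r = 1) (h1 : r ≠ 1) :
    {g : GL (Fin 3) ℤ | g * r = r * g}.Finite := by
  let f : Matrix (Fin 3) (Fin 3) ℤ →+* Matrix (Fin 3) (Fin 3) ℚ := (Int.castRingHom ℚ).mapMatrix
  have finj : Function.Injective f := Matrix.map_injective Int.cast_injective
  obtain ⟨P, hP, hRP⟩ := normal_form (f r.1)
    (by rw [← map_mul, ← map_mul, ← Units.val_mul, ← Units.val_mul, h3]; simp)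
    (fun h => h1 (Units.ext (finj (by rw [h]; simp))))
  have hPu : IsUnit P.det := isUnit_iff_ne_zero.2 hP
  have PP : P * P⁻¹ = 1 := Matrix.mul_nonsing_inv _ hPu
  have PP' : P⁻¹ * P = 1 := Matrix.nonsing_inv_mul _ hPu
  have hR : f r.1 = P * C * P⁻¹ := by rw [← hRP, mul_assoc, PP, mul_one]
  let F : ℤ × ℤ × ℤ → Matrix (Fin 3) (Fin 3) ℚ := fun t =>
    P * D (t.1 / 3) (t.2.1 / 3) (t.2.2 / 3) * P⁻¹
  have hfin : (F '' (Set.Icc (-27) 27 ×ˢ Set.Icc (-6) 6 ×ˢ Set.Icc (-6) 6)).Finite :=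
    Set.Finite.image _ ((Set.finite_Icc _ _).prod ((Set.finite_Icc _ _).prod (Set.finite_Icc _ _)))
  refine Set.Finite.of_finite_image (f := fun g : GL (Fin 3) ℤ => f g.1) (hfin.subset ?_)
    (fun g _ g' _ h => Units.ext (finj h))
  rintro _ ⟨g, hg, rfl⟩
  simp only [Set.mem_ofPred_eq] at hg
  obtain ⟨E, hE⟩ : ∃ E, E = P⁻¹ * f g.1 * P := ⟨_, rfl⟩
  have hgE : f g.1 = P * E * P⁻¹ := by
    rw [hE]
    calc f g.1 = (P * P⁻¹) * f g.1 * (P * P⁻¹) := by rw [PP]; simp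
      _ = _ := by simp only [mul_assoc]
  have hcomm : f g.1 * f r.1 = f r.1 * f g.1 := by
    rw [← map_mul, ← map_mul, ← Units.val_mul, hg, Units.val_mul]
  have conj : ∀ A B : Matrix (Fin 3) (Fin 3) ℚ, (P * A * P⁻¹) * (P * B * P⁻¹)
      = P * (A * B) * P⁻¹ := by
    intro A B
    calc _ = P * A * (P⁻¹ * P) * B * P⁻¹ := by simp only [mul_assoc]
      _ = _ := by rw [PP']; simp only [mul_assoc, one_mul]
  have hEC : E * C = C * E := by
    have := hcomm
    rw [hgE, hR, conj, conj] at this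
    have := congrArg (fun M => P⁻¹ * M * P) this
    have cc : ∀ A, P⁻¹ * (P * A * P⁻¹) * P = A := by
      intro A
      calc _ = (P⁻¹ * P) * A * (P⁻¹ * P) := by simp only [mul_assoc]
        _ = _ := by rw [PP']; simp
    simpa only [cc] using this
  have hED := commutant E hEC
  obtain ⟨α, hα⟩ : ∃ α, α = E 0 0 := ⟨_, rfl⟩
  obtain ⟨β, hβ⟩ : ∃ α, α = E 1 1 := ⟨_, rfl⟩
  obtain ⟨γ, hγ⟩ : ∃ α, α = E 2 1 := ⟨_, rfl⟩
  rw [← hα, ← hβ, ← hγ] at hED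
  have tr : ∀ A, (P * A * P⁻¹).trace = A.trace := by
    intro A
    rw [Matrix.trace_mul_comm, ← mul_assoc, PP', one_mul]
  have trf : ∀ M, (f M).trace = (M.trace : ℚ) := by
    intro M
    simp [f, Matrix.trace]
  have t0 : ((g.1.trace : ℤ) : ℚ) = α + 2 * β - γ := by
    rw [← trf, hgE, tr, hED]; simp [D, Matrix.trace, Fin.sum_univ_three]; ring
  have t1 : (((g.1 * r.1).trace : ℤ) : ℚ) = α - β - γ := by
    rw [← trf, map_mul, hgE, hR, conj, tr, hED]
    simp [D, C, Matrix.trace, Fin.sum_univ_three, Matrix.mul_apply]; ring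
  have t2 : (((g.1 * r.1 * r.1).trace : ℤ) : ℚ) = α - β + 2 * γ := by
    rw [← trf, map_mul, map_mul, hgE, hR, conj, conj, tr, hED]
    simp [D, C, Matrix.trace, Fin.sum_univ_three, Matrix.mul_apply]; ring
  generalize g.1.trace = x at t0
  generalize (g.1 * r.1).trace = y at t1
  generalize (g.1 * r.1 * r.1).trace = z at t2
  have hdet : ((g.1.det : ℤ) : ℚ) = α * (β ^ 2 - β * γ + γ ^ 2) := by
    have e1 : (f g.1).det = ((g.1.det : ℤ) : ℚ) := by
      exact ((Int.castRingHom ℚ).map_det g.1).symm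
    have e2 : (P * E * P⁻¹).det = E.det := by
      rw [Matrix.det_mul_comm, ← mul_assoc, PP', one_mul]
    rw [← e1, hgE, e2, hED]
    simp [D, Matrix.det_fin_three]; ring
  have hunit : g.1.det = 1 ∨ g.1.det = -1 :=
    Int.isUnit_iff.1 ((Matrix.isUnit_iff_isUnit_det _).1 g.isUnit)
  have ea : α = ((x + y + z : ℤ) : ℚ) / 3 := by push_cast; linarith
  have eb : β = ((x - y : ℤ) : ℚ) / 3 := by push_cast; linarith
  have ec : γ = ((z - y : ℤ) : ℚ) / 3 := by push_cast; linarith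
  refine ⟨(x + y + z, x - y, z - y), ?_, ?_⟩
  · apply bounds
    generalize x + y + z = a at *
    generalize x - y = b at *
    generalize z - y = c at *
    have : ((a * (b ^ 2 - b * c + c ^ 2) : ℤ) : ℚ) = ((27 * g.1.det : ℤ) : ℚ) := by
      rw [Int.cast_mul 27, hdet]
      push_cast
      rw [ea, eb, ec]; ring
    have := Int.cast_injective this
    rcases hunit with h | h <;> rw [h] at this
    · left; linarith
    · right; linarith
  · simp only [F]
    rw [← ea, ← eb, ← ec, ← hED, ← hgE]

end Sharp3

/-- `GL₃(ℤ)` does not contain an infinite subgroup admitting a (faithful)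
sharply 3-transitive action on some set. -/
theorem stmt_7 :
    ¬ ∃ (H : Subgroup (GL (Fin 3) ℤ)) (X : Type) (φ : H →* Equiv.Perm X),
      Infinite H ∧ Function.Injective φ ∧
      (∃ a b c : X, a ≠ b ∧ a ≠ c ∧ b ≠ c) ∧
      (∀ x₁ x₂ x₃ y₁ y₂ y₃ : X, x₁ ≠ x₂ → x₁ ≠ x₃ → x₂ ≠ x₃ →
        y₁ ≠ y₂ → y₁ ≠ y₃ → y₂ ≠ y₃ →
        ∃! g : H, φ g x₁ = y₁ ∧ φ g x₂ = y₂ ∧ φ g x₃ = y₃) := by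
  rintro ⟨H, X, φ, hH, hφ, ⟨a, b, c, hab, hac, hbc⟩, h⟩
  have hX : Infinite X := by
    by_contra hX
    rw [not_infinite_iff_finite] at hX
    have := Finite.of_injective _ hφ
    exact not_finite H
  have uniq : ∀ (g g' : H) (x y z : X), x ≠ y → x ≠ z → y ≠ z → φ g x = φ g' x →
      φ g y = φ g' y → φ g z = φ g' z → g = g' := by
    intro g g' x y z hxy hxz hyz h1 h2 h3
    have i := (φ g').injective
    exact (h x y z (φ g' x) (φ g' y) (φ g' z) hxy hxz hyz (i.ne hxy) (i.ne hxz) (i.ne hyz)).unique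
      ⟨h1, h2, h3⟩ ⟨rfl, rfl, rfl⟩
  obtain ⟨r, ⟨ra, rb, rc⟩, -⟩ := h a b c b c a hab hac hbc hbc hab.symm hac.symm
  have r3 : r * r * r = 1 :=
    uniq _ _ a b c hab hac hbc (by simp [ra, rb, rc]) (by simp [ra, rb, rc]) (by simp [ra, rb, rc])
  have r1 : r ≠ 1 := by
    rintro rfl
    simp at ra
    exact hab ra
  have r3' : ∀ x, φ r (φ r (φ r x)) = x := by
    intro x
    have := congrArg (fun g => φ g x) r3
    simpa using this
  have hfin := Sharp3.finite_centralizer r.1 (by exact_mod_cast congrArg Subtype.val r3)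
    (fun e => r1 (Subtype.ext e))
  have hfin' : {g : H | g * r = r * g}.Finite := by
    refine Set.Finite.of_finite_image (f := Subtype.val) (hfin.subset ?_)
      Subtype.val_injective.injOn
    rintro _ ⟨g, hg, rfl⟩
    exact congrArg Subtype.val hg
  have hF : {x | φ r x = x}.Finite := by
    by_contra hinf
    obtain ⟨t, ht, hc⟩ := Set.Infinite.exists_subset_card_eq hinf 3
    classical
    obtain ⟨x, y, z, hxy, hxz, hyz, rfl⟩ := Finset.card_eq_three.1 hc
    apply r1
    have hx : φ r x = x := ht (by simp)
    have hy : φ r y = y := ht (by simp)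
    have hz : φ r z = z := ht (by simp)
    exact uniq _ _ x y z hxy hxz hyz (by simp [hx]) (by simp [hy]) (by simp [hz])
  refine Set.infinite_univ (α := X) ((hF.union (hfin'.image fun g => φ g a)).subset ?_)
  intro x _
  by_cases hx : φ r x = x
  · exact Or.inl hx
  right
  have i := (φ r).injective
  have d1 : x ≠ φ r x := fun e => hx e.symm
  have d2 : φ r x ≠ φ r (φ r x) := i.ne d1
  have d3 : x ≠ φ r (φ r x) := by
    intro e
    apply hx
    have := r3' x
    rwa [← e] at this
  obtain ⟨g, ⟨ga, gb, gc⟩, -⟩ := h a b c _ _ _ hab hac hbc d1 d3 d2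
  refine ⟨g, ?_, ga⟩
  exact uniq _ _ a b c hab hac hbc (by simp [ra, ga, gb]) (by simp [rb, gb, gc])
    (by simp [rc, ga, gc, r3'])
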